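/- For α with |Re(α)| < 1 and complex λ₁, λ₂ with Re(λ₁), Re(λ₂) > 0 and λ₁² ≠ λ₂², the bilinear integral of Gegenbauer Z-functions satisfies ∫₁^∞ 𝐙_{α,λ₁}(w) 𝐙_{α,λ₂}(w) (w²−1)^α d(2w) = ( 2^{λ₁+λ₂+1} / ((λ₁²−λ₂²) sin πα) ) · ( 1/(Γ(1/2−α+λ₁)Γ(1/2+α+λ₂)) − 1/(Γ(1/2−α+λ₂)Γ(1/2+α+λ₁)) ), for α ≠ 0. -/

import Mathlib

open MeasureTheory Set Complex Real Polynomial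

/-- The Gauss hypergeometric series `F(a,b;c;z)`. -/
noncomputable def hyperF (a b c z : ℂ) : ℂ :=
  ∑' n : ℕ, ((ascPochhammer ℂ n).eval a * (ascPochhammer ℂ n).eval b
      / (ascPochhammer ℂ n).eval c) * z ^ n / (n.factorial : ℂ)

/-- The Gegenbauer function `𝐙_{α,λ}` in Olver's normalization, for `w > 1`. -/
noncomputable def gegenbauerZ (α lam : ℂ) (w : ℝ) : ℂ :=
  (1 / Complex.Gamma (lam + 1)) * (w : ℂ) ^ (-(1 / 2 : ℂ) - α - lam)
    * hyperF (1 / 4 + α / 2 + lam / 2) (3 / 4 + α / 2 + lam / 2) (1 + lam)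
        (1 / (w : ℂ) ^ 2)

noncomputable def hco (a b c : ℂ) (n : ℕ) : ℂ :=
  ((ascPochhammer ℂ n).eval a * (ascPochhammer ℂ n).eval b
      / (ascPochhammer ℂ n).eval c) / (n.factorial : ℂ)

lemma hyperF_eq (a b c z : ℂ) : hyperF a b c z = ∑' n : ℕ, hco a b c n * z ^ n := by
  unfold hyperF hco
  congr 1; ext n; ring

lemma add_nat_ne {c : ℂ} (hc : 0 < c.re) (n : ℕ) : c + n ≠ 0 := by
  intro h
  have := congrArg Complex.re h
  simp at this
  have h2 : (0:ℝ) ≤ n := Nat.cast_nonneg n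
  linarith

lemma asc_ne {c : ℂ} (hc : 0 < c.re) (n : ℕ) : (ascPochhammer ℂ n).eval c ≠ 0 := by
  induction n with
  | zero => simp
  | succ n ih => rw [ascPochhammer_succ_eval]; exact mul_ne_zero ih (add_nat_ne hc n)

lemma hco_zero (a b c : ℂ) : hco a b c 0 = 1 := by simp [hco]

lemma hco_succ (a b c : ℂ) (n : ℕ) :
    hco a b c (n + 1) = hco a b c n * ((a + n) * (b + n) / ((c + n) * (n + 1))) := by
  unfold hco
  rw [ascPochhammer_succ_eval, ascPochhammer_succ_eval, ascPochhammer_succ_eval,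
    Nat.factorial_succ]
  push_cast
  simp only [div_eq_mul_inv, mul_inv]
  ring

lemma natsucc_ne (n : ℕ) : (n : ℂ) + 1 ≠ 0 := by exact_mod_cast Nat.succ_ne_zero n

lemma re_pos_ne {c : ℂ} (hc : 0 < c.re) : c ≠ 0 := by
  rintro rfl; simp at hc

lemma hco_shift (a b : ℂ) {c : ℂ} (hc : 0 < c.re) (n : ℕ) :
    ((n : ℂ) + 1) * hco a b c (n + 1) = a * b / c * hco (a + 1) (b + 1) (c + 1) n := by
  induction n with
  | zero =>
    rw [hco_succ, hco_zero, hco_zero]; simp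
  | succ n ih =>
    have h1 := natsucc_ne n
    have h2 := natsucc_ne (n + 1)
    have h3 := add_nat_ne hc (n + 1)
    push_cast at h2 h3
    have h4 : c + 1 + n ≠ 0 := by rw [add_assoc, add_comm (1:ℂ)]; exact h3
    rw [hco_succ a b c (n + 1), hco_succ (a + 1), ← mul_assoc (a * b / c), ← ih]
    push_cast
    field_simp
    ring

lemma hco_c (a b : ℂ) {c : ℂ} (hc : 0 < c.re) (n : ℕ) :
    (c + n) * hco a b (c + 1) n = c * hco a b c n := by
  induction n with
  | zero => simp [hco_zero]
  | succ n ih =>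
    have h1 := natsucc_ne n
    have h3 := add_nat_ne hc (n + 1)
    have h5 := add_nat_ne hc n
    push_cast at h3
    have h4 : c + 1 + n ≠ 0 := by rw [add_assoc, add_comm (1:ℂ)]; exact h3
    rw [hco_succ a b c n, hco_succ a b (c + 1), ← mul_assoc c, ← ih]
    push_cast
    field_simp
    ring

lemma hco_ii (a b : ℂ) {c : ℂ} (hc : 0 < c.re) (n : ℕ) :
    ((n : ℂ) + 1) * hco a b c (n + 1) - n * hco a b c n - (a + b - c) * hco a b c n
      = (c - a) * (c - b) / c * hco a b (c + 1) n := by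
  have h1 := natsucc_ne n
  have h5 := add_nat_ne hc n
  have hc0 := re_pos_ne hc
  have := hco_c a b hc n
  have h : hco a b (c + 1) n = c * hco a b c n / (c + n) := by
    field_simp; linear_combination this
  rw [h, hco_succ]
  field_simp
  ring

lemma hco_summable (a b : ℂ) {c : ℂ} (hc : 0 < c.re) {r : ℝ} (hr : 0 ≤ r) (hr1 : r < 1) :
    Summable fun n => ‖hco a b c n‖ * r ^ n := by
  obtain ⟨s, hs, hs1⟩ := exists_between hr1
  have hs0 : 0 < s := lt_of_le_of_lt hr hs
  have key : ∀ x : ℂ, Filter.Tendsto (fun n : ℕ => (x + n) / ((n:ℂ) + 1)) Filter.atTop (nhds 1) := by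
    intro x
    have h1 : Filter.Tendsto (fun n : ℕ => (1:ℂ) / ((n:ℂ) + 1)) Filter.atTop (nhds 0) :=
      tendsto_one_div_add_atTop_nhds_zero_nat
    have h2 := ((h1.const_mul (x - 1)).const_add 1)
    simp only [mul_zero, add_zero] at h2
    refine h2.congr fun n => ?_
    have := natsucc_ne n
    field_simp
    ring
  have hrat : Filter.Tendsto (fun n : ℕ => ‖((a + n) * (b + n) / ((c + n) * ((n:ℂ) + 1)))‖ * r)
      Filter.atTop (nhds r) := by
    have h := ((((key a).mul (key b)).div (key c) one_ne_zero).norm).mul_const r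
    simp only [mul_one, div_one, norm_one, one_mul] at h
    refine h.congr fun n => ?_
    have := natsucc_ne n
    have := add_nat_ne hc n
    congr 2
    simp only [Pi.div_apply]
    field_simp
  refine summable_of_ratio_norm_eventually_le hs1 ?_
  filter_upwards [hrat.eventually (gt_mem_nhds hs)] with n hn
  rw [Real.norm_of_nonneg (by positivity), Real.norm_of_nonneg (by positivity), hco_succ, norm_mul, pow_succ]
  calc _ = (‖(a + ↑n) * (b + ↑n) / ((c + ↑n) * (↑n + 1))‖ * r) * (‖hco a b c n‖ * r ^ n) := by ring
    _ ≤ _ := by gcongr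

lemma hco_summable' (a b : ℂ) {c z : ℂ} (hc : 0 < c.re) (hz : ‖z‖ < 1) :
    Summable fun n => hco a b c n * z ^ n := by
  refine Summable.of_norm ?_
  simpa using hco_summable a b hc (norm_nonneg z) hz

lemma hyperF_hasDerivAt (a b : ℂ) {c z : ℂ} (hc : 0 < c.re) (hz : ‖z‖ < 1) :
    HasDerivAt (hyperF a b c) (a * b / c * hyperF (a + 1) (b + 1) (c + 1) z) z := by
  obtain ⟨r, hr, hr1⟩ := exists_between hz
  have hr0 : 0 ≤ r := (norm_nonneg z).trans hr.le
  have hc1 : 0 < (c + 1).re := by simp; linarith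
  have e : (hyperF a b c) = fun y => ∑' n, hco a b c n * y ^ n := by
    ext y; exact hyperF_eq _ _ _ _
  have hS := (hco_summable (a + 1) (b + 1) hc1 hr0 hr1).mul_left ‖a * b / c‖
  have hd : ∀ n : ℕ, ∀ y : ℂ, hco a b c (n + 1) * (((n + 1 : ℕ) : ℂ) * y ^ n) =
      a * b / c * (hco (a + 1) (b + 1) (c + 1) n * y ^ n) := by
    intro n y
    rw [← mul_assoc (a * b / c), ← hco_shift a b hc]; push_cast; ring
  have main := hasDerivAt_tsum_of_isPreconnected (𝕜 := ℂ)
    (u := fun n => match n with | 0 => 0 | n + 1 => ‖a * b / c‖ * (‖hco (a + 1) (b + 1) (c + 1) n‖ * r ^ n))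
    (g := fun n y => hco a b c n * y ^ n) (g' := fun n y => hco a b c n * ((n : ℂ) * y ^ (n - 1)))
    (t := Metric.ball 0 r) (y₀ := 0) (y := z) ?_ Metric.isOpen_ball
    (convex_ball _ _).isPreconnected ?_ ?_ ?_ ?_ ?_
  · rw [e]
    refine main.congr_deriv ?_
    rw [Summable.tsum_eq_zero_add]
    · simp only [Nat.cast_zero, zero_mul, mul_zero, zero_add, Nat.add_sub_cancel, hd]
      rw [tsum_mul_left, hyperF_eq]
    · rw [← summable_nat_add_iff 1]
      simp only [Nat.add_sub_cancel, hd]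
      exact (hco_summable' _ _ hc1 hz).mul_left _
  · rw [← summable_nat_add_iff 1]; exact hS
  · intro n y _
    exact (hasDerivAt_pow n y).const_mul _
  · intro n y hy
    rcases n with _ | n
    · simp
    · simp only [Nat.add_sub_cancel, hd]
      rw [norm_mul, norm_mul, norm_pow]
      have : ‖y‖ ≤ r := by simpa using (mem_ball_zero_iff.1 hy).le
      gcongr
  · exact Metric.mem_ball_self (lt_of_le_of_lt (norm_nonneg z) hr)
  · exact hco_summable' _ _ hc (by simp)
  · simpa using hr

/-- `z F' = Σ n u_n z^n` -/
lemma hyperF_theta (a b : ℂ) {c z : ℂ} (hc : 0 < c.re) (hz : ‖z‖ < 1) :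
    HasSum (fun n : ℕ => (n : ℂ) * hco a b c n * z ^ n)
      (z * (a * b / c * hyperF (a + 1) (b + 1) (c + 1) z)) := by
  have hc1 : 0 < (c + 1).re := by simp; linarith
  rw [← hasSum_nat_add_iff' 1]
  simp only [Finset.sum_range_one, Nat.cast_zero, zero_mul, sub_zero]
  have h := ((hco_summable' (a + 1) (b + 1) hc1 hz).hasSum.mul_left (a * b / c)).mul_left z
  rw [← hyperF_eq] at h
  convert! h using 2 with n
  have := hco_shift a b hc n
  push_cast
  rw [this]; ring

lemma hyperF_deriv_sum (a b : ℂ) {c z : ℂ} (hc : 0 < c.re) (hz : ‖z‖ < 1) :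
    HasSum (fun n : ℕ => ((n : ℂ) + 1) * hco a b c (n + 1) * z ^ n)
      (a * b / c * hyperF (a + 1) (b + 1) (c + 1) z) := by
  have hc1 : 0 < (c + 1).re := by simp; linarith
  have h := ((hco_summable' (a + 1) (b + 1) hc1 hz).hasSum.mul_left (a * b / c))
  rw [← hyperF_eq] at h
  simp only [hco_shift a b hc, mul_assoc] at h ⊢
  exact h

lemma hyperF_hasSum (a b : ℂ) {c z : ℂ} (hc : 0 < c.re) (hz : ‖z‖ < 1) :
    HasSum (fun n : ℕ => hco a b c n * z ^ n) (hyperF a b c z) := by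
  rw [hyperF_eq]; exact (hco_summable' a b hc hz).hasSum

lemma hyperF_ii (a b : ℂ) {c z : ℂ} (hc : 0 < c.re) (hz : ‖z‖ < 1) :
    (1 - z) * (a * b / c * hyperF (a + 1) (b + 1) (c + 1) z) - (a + b - c) * hyperF a b c z
      = (c - a) * (c - b) / c * hyperF a b (c + 1) z := by
  have hc1 : 0 < (c + 1).re := by simp; linarith
  have h := ((hyperF_deriv_sum a b hc hz).sub (hyperF_theta a b hc hz)).sub
    ((hyperF_hasSum a b hc hz).mul_left (a + b - c))
  have h2 := (hyperF_hasSum a b hc1 hz).mul_left ((c - a) * (c - b) / c)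
  rw [sub_mul, one_mul]
  refine h.unique ?_
  convert! h2 using 2 with n
  linear_combination z ^ n * hco_ii a b hc n

lemma hyperF_iii (a b : ℂ) {c z : ℂ} (hc : 0 < c.re) (hz : ‖z‖ < 1) :
    z * (a * b / (c + 1) * hyperF (a + 1) (b + 1) (c + 1 + 1) z) + c * hyperF a b (c + 1) z
      = c * hyperF a b c z := by
  have hc1 : 0 < (c + 1).re := by simp; linarith
  have h := (hyperF_theta a b hc1 hz).add ((hyperF_hasSum a b hc1 hz).mul_left c)
  refine h.unique ?_
  convert! (hyperF_hasSum a b hc hz).mul_left c using 2 with n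
  linear_combination z ^ n * hco_c a b hc n

lemma hyperF_zero (a b c : ℂ) : hyperF a b c 0 = 1 := by
  rw [hyperF_eq, tsum_eq_single 0]
  · simp [hco_zero]
  · intro n hn; simp [hn]

noncomputable def eulU (a b c z : ℂ) : ℂ :=
  (1 - z) ^ (a + b - c) * hyperF a b c z - hyperF (c - a) (c - b) c z

lemma one_sub_slit {z : ℂ} (hz : ‖z‖ < 1) : 1 - z ∈ Complex.slitPlane := by
  left
  have := (Complex.abs_re_le_norm z)
  have := le_abs_self z.re
  simp; linarith

lemma eulU_deriv (a b : ℂ) {c z : ℂ} (hc : 0 < c.re) (hz : ‖z‖ < 1) :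
    HasDerivAt (eulU a b c) ((c - a) * (c - b) / c * eulU a b (c + 1) z) z := by
  have hsl := one_sub_slit hz
  have h0 : 1 - z ≠ 0 := Complex.slitPlane_ne_zero hsl
  have h1 : HasDerivAt (fun y : ℂ => 1 - y) (-1) z := by
    simpa using (hasDerivAt_id z).const_sub 1
  have h2 := h1.cpow_const (c := a + b - c) hsl
  have h3 := (h2.mul (hyperF_hasDerivAt a b hc hz)).sub
    (hyperF_hasDerivAt (c - a) (c - b) hc hz)
  refine h3.congr_deriv ?_
  have e := hyperF_ii a b hc hz
  have e1 : (1 - z) ^ (a + b - c) = (1 - z) ^ (a + b - c - 1) * (1 - z) := by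
    rw [Complex.cpow_sub (a + b - c) 1 h0, Complex.cpow_one]; field_simp
  unfold eulU
  rw [e1, show a + b - (c + 1) = a + b - c - 1 by ring, show c + 1 - a = c - a + 1 by ring,
    show c + 1 - b = c - b + 1 by ring]
  linear_combination (1 - z) ^ (a + b - c - 1) * e

lemma eulU_iter (a b : ℂ) (n : ℕ) : ∀ {c : ℂ}, 0 < c.re → iteratedDeriv n (eulU a b c) 0 = 0 := by
  induction n with
  | zero => intro c hc; simp [eulU, hyperF_zero]
  | succ n ih =>
    intro c hc
    have hc1 : 0 < (c + 1).re := by simp; linarith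
    rw [iteratedDeriv_succ']
    have : deriv (eulU a b c) =ᶠ[nhds 0] fun z => (c - a) * (c - b) / c * eulU a b (c + 1) z := by
      filter_upwards [Metric.ball_mem_nhds (0:ℂ) one_pos] with z hz
      exact (eulU_deriv a b hc (by simpa using hz)).deriv
    rw [this.iteratedDeriv_eq, iteratedDeriv_const_mul_field, ih hc1, mul_zero]

lemma euler_transf (a b : ℂ) {c z : ℂ} (hc : 0 < c.re) (hz : ‖z‖ < 1) :
    (1 - z) ^ (a + b - c) * hyperF a b c z = hyperF (c - a) (c - b) c z := by
  have hd : DifferentiableOn ℂ (eulU a b c) (Metric.ball 0 1) := fun y hy =>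
    (eulU_deriv a b hc (by simpa using hy)).differentiableAt.differentiableWithinAt
  have h := Complex.taylorSeries_eq_on_ball' (z := z) (by simpa using hz) hd
  simp only [eulU_iter a b _ hc, mul_zero, zero_mul, tsum_zero] at h
  exact sub_eq_zero.1 h.symm

lemma asc_prod (s : ℂ) (n : ℕ) :
    (ascPochhammer ℂ n).eval s = ∏ j ∈ Finset.range n, (s + j) := by
  induction n with
  | zero => simp
  | succ n ih => rw [ascPochhammer_succ_eval, Finset.prod_range_succ, ih]

lemma asc_gammaSeq_inv (s : ℂ) (n : ℕ) (hn : n ≠ 0) :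
    (ascPochhammer ℂ (n + 1)).eval s = (n : ℂ) ^ s * n.factorial * (Complex.GammaSeq s n)⁻¹ := by
  unfold Complex.GammaSeq
  rw [asc_prod]
  have h1 : (n : ℂ) ≠ 0 := by exact_mod_cast hn
  have h2 : (n : ℂ) ^ s ≠ 0 := by simp [Complex.cpow_eq_zero_iff, h1]
  have h3 : (n.factorial : ℂ) ≠ 0 := by exact_mod_cast n.factorial_ne_zero
  rw [inv_div, mul_div_assoc', mul_div_cancel_left₀ _ (mul_ne_zero h2 h3)]

lemma hco_summable_one (a b : ℂ) {c : ℂ} (hc : 0 < c.re) (h : 0 < (c - a - b).re) :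
    Summable fun n => ‖hco a b c n‖ := by
  by_cases ha : Complex.Gamma a = 0 ∨ Complex.Gamma b = 0
  · have : ∃ m : ℕ, a = -m ∨ b = -m := by
      rcases ha with ha | ha
      · obtain ⟨m, hm⟩ := (Complex.Gamma_eq_zero_iff a).1 ha; exact ⟨m, Or.inl hm⟩
      · obtain ⟨m, hm⟩ := (Complex.Gamma_eq_zero_iff b).1 ha; exact ⟨m, Or.inr hm⟩
    obtain ⟨m, hm⟩ := this
    refine summable_of_hasFiniteSupport ((Set.finite_Iic m).subset ?_)
    intro n hn
    by_contra hlt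
    have hlt : m < n := by simpa using hlt
    apply hn
    have : (ascPochhammer ℂ n).eval (-(m:ℂ)) = 0 := by
      rw [asc_prod]; exact Finset.prod_eq_zero (Finset.mem_range.2 hlt) (by simp)
    rcases hm with rfl | rfl <;> simp [hco, this]
  · push Not at ha
    rw [← summable_nat_add_iff 1]
    set R : ℕ → ℂ := fun n => (Complex.GammaSeq a n)⁻¹ * (Complex.GammaSeq b n)⁻¹ * Complex.GammaSeq c n
    have hR : Filter.Tendsto R Filter.atTop
        (nhds ((Complex.Gamma a)⁻¹ * (Complex.Gamma b)⁻¹ * Complex.Gamma c)) :=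
      (((Complex.GammaSeq_tendsto_Gamma a).inv₀ ha.1).mul
        ((Complex.GammaSeq_tendsto_Gamma b).inv₀ ha.2)).mul (Complex.GammaSeq_tendsto_Gamma c)
    have hp : Summable fun n : ℕ => (n : ℝ) ^ (-1 - (c - a - b).re) :=
      Real.summable_nat_rpow.2 (by linarith)
    refine summable_of_isBigO_nat hp ?_
    have hO : R =O[Filter.atTop] (fun _ => (1:ℝ)) := hR.isBigO_one ℝ
    have hO2 := hO.norm_left.mul (Asymptotics.isBigO_refl (fun n : ℕ => (n : ℝ) ^ (-1 - (c - a - b).re)) Filter.atTop)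
    simp only [one_mul] at hO2
    refine Asymptotics.IsBigO.trans ?_ hO2
    refine Asymptotics.IsBigO.of_bound 1 ?_
    filter_upwards [Filter.eventually_gt_atTop 0] with n hn
    have hn0 : n ≠ 0 := hn.ne'
    have hnR : (0:ℝ) < n := by exact_mod_cast hn
    have h1 : (n : ℂ) ≠ 0 := by exact_mod_cast hn0
    have e : hco a b c (n + 1) = R n * ((n : ℂ) ^ (a + b - c) / ((n : ℂ) + 1)) := by
      have h2 : (n : ℂ) ^ c ≠ 0 := by simp [Complex.cpow_eq_zero_iff, h1]
      have h3 : (n.factorial : ℂ) ≠ 0 := by exact_mod_cast n.factorial_ne_zero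
      have h4 := natsucc_ne n
      simp only [hco, asc_gammaSeq_inv _ n hn0, R, Nat.factorial_succ,
        Complex.cpow_sub _ _ h1, Complex.cpow_add _ _ h1]
      push_cast
      field_simp
    rw [e, one_mul, norm_norm, norm_mul (R n), norm_mul ‖R n‖, norm_norm]
    gcongr
    rw [norm_div, Complex.norm_natCast_cpow_of_pos hn]
    have h5 : ‖(n:ℂ) + 1‖ = n + 1 := by
      rw [show (n:ℂ) + 1 = ((n + 1 : ℕ) : ℂ) by push_cast; rfl, Complex.norm_natCast]; push_cast; rfl
    rw [h5, Real.norm_of_nonneg (by positivity)]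
    have h6 : (n:ℝ) ^ (-1 - (c - a - b).re) = (n:ℝ) ^ (a + b - c).re / n := by
      rw [show -1 - (c - a - b).re = (a + b - c).re - 1 by simp; ring, Real.rpow_sub_one hnR.ne']
    rw [h6]
    gcongr
    linarith

lemma gauss_step (a b : ℂ) {c : ℂ} (hc : 0 < c.re) (h : 0 < (c - a - b).re) :
    (c - a - b) * hyperF a b c 1 = (c - a) * (c - b) / c * hyperF a b (c + 1) 1 := by
  have hc1 : 0 < (c + 1).re := by simp; linarith
  have h' : 0 < (c + 1 - a - b).re := by simp at h ⊢; linarith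
  have S1 := (hco_summable_one a b hc h).of_norm.hasSum
  have S2 := (hco_summable_one a b hc1 h').of_norm.hasSum
  have T := (S2.mul_left ((c - a) * (c - b) / c)).sub (S1.mul_left (c - a - b))
  have e : ∀ n : ℕ, (c - a) * (c - b) / c * hco a b (c + 1) n - (c - a - b) * hco a b c n
      = ((n + 1 : ℕ) : ℂ) * hco a b c (n + 1) - n * hco a b c n := by
    intro n; rw [← hco_ii a b hc n]; push_cast; ring
  simp only [e] at T
  have T2 := T.tendsto_sum_nat
  simp only [Finset.sum_range_sub (fun n : ℕ => (n:ℂ) * hco a b c n)] at T2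
  simp only [Nat.cast_zero, zero_mul, sub_zero] at T2
  set L := (c - a) * (c - b) / c * ∑' n, hco a b (c + 1) n - (c - a - b) * ∑' n, hco a b c n with hL
  have hL0 : L = 0 := by
    by_contra hne
    -- then `|u_n| ≥ (|L|/2)/n`, contradicting summability
    have T3 := T2.norm
    have hpos : 0 < ‖L‖ := norm_pos_iff.2 hne
    have ev := T3.eventually (lt_mem_nhds (show ‖L‖ / 2 < ‖L‖ by linarith))
    refine Real.not_summable_one_div_natCast ?_
    refine summable_of_isBigO_nat (hco_summable_one a b hc h) ?_
    refine Asymptotics.IsBigO.of_bound (2 / ‖L‖) ?_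
    filter_upwards [ev, Filter.eventually_gt_atTop 0] with n hn hn0
    have hnR : (0:ℝ) < n := by exact_mod_cast hn0
    rw [norm_mul, Complex.norm_natCast] at hn
    rw [norm_norm, Real.norm_of_nonneg (by positivity)]
    rw [div_mul_eq_mul_div, div_le_div_iff₀ hnR hpos]
    linarith
  simp only [hyperF_eq, one_pow, mul_one]
  rw [hL] at hL0
  linear_combination -hL0

lemma gauss_iter (a b : ℂ) {c : ℂ} (hc : 0 < c.re) (h : 0 < (c - a - b).re) (N : ℕ) :
    hyperF a b c 1 * ((ascPochhammer ℂ N).eval c * (ascPochhammer ℂ N).eval (c - a - b))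
     = (ascPochhammer ℂ N).eval (c - a) * (ascPochhammer ℂ N).eval (c - b) * hyperF a b (c + N) 1 := by
  induction N with
  | zero => simp
  | succ N ih =>
    have hcN : 0 < (c + N).re := by simp; positivity
    have hN : 0 < (c + N - a - b).re := by
      have : (0:ℝ) ≤ N := Nat.cast_nonneg N
      simp at h ⊢; linarith
    have g := gauss_step a b hcN hN
    have h0 := re_pos_ne hcN
    simp only [ascPochhammer_succ_eval]
    push_cast
    rw [← add_assoc]
    have g2 : (c + N) * (c - a - b + N) * hyperF a b (c + N) 1 =
        (c - a + N) * (c - b + N) * hyperF a b (c + N + 1) 1 := by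
      field_simp at g
      linear_combination g
    linear_combination (c + N) * (c - a - b + N) * ih + (ascPochhammer ℂ N).eval (c - a) * (ascPochhammer ℂ N).eval (c - b) * g2

lemma gauss_lim (a b : ℂ) {c : ℂ} (hc : 0 < c.re) (h : 0 < (c - a - b).re) :
    Filter.Tendsto (fun N : ℕ => hyperF a b (c + N) 1) Filter.atTop (nhds 1) := by
  have hmono : ∀ N n : ℕ, ‖(ascPochhammer ℂ n).eval c‖ ≤ ‖(ascPochhammer ℂ n).eval (c + N)‖ := by
    intro N n
    rw [asc_prod, asc_prod, norm_prod, norm_prod]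
    refine Finset.prod_le_prod (fun _ _ => norm_nonneg _) fun j _ => ?_
    rw [Complex.norm_def, Complex.norm_def]
    apply Real.sqrt_le_sqrt
    simp only [Complex.normSq_apply, Complex.add_re, Complex.add_im, Complex.natCast_re, Complex.natCast_im, add_zero]
    have : (0:ℝ) ≤ N := Nat.cast_nonneg N
    have : (0:ℝ) ≤ j := Nat.cast_nonneg j
    nlinarith
  have key := tendsto_tsum_of_dominated_convergence (𝓕 := Filter.atTop)
    (f := fun N n => hco a b (c + (N : ℕ)) n) (g := fun n => if n = 0 then (1:ℂ) else 0)
    (hco_summable_one a b hc h) ?_ ?_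
  · simp only [tsum_ite_eq] at key
    simpa only [hyperF_eq, one_pow, mul_one] using key
  · intro n
    rcases n with _ | n
    · simp [hco_zero]
    · simp only [Nat.add_eq_zero_iff, one_ne_zero, and_false, if_false]
      have e : ∀ N : ℕ, hco a b (c + N) (n + 1) = ((ascPochhammer ℂ (n+1)).eval a * (ascPochhammer ℂ (n+1)).eval b / ((n+1).factorial : ℂ)) * ((ascPochhammer ℂ (n+1)).eval (c + N))⁻¹ := by
        intro N; unfold hco; simp only [div_eq_mul_inv]; ring
      simp only [e]
      rw [← mul_zero ((ascPochhammer ℂ (n+1)).eval a * (ascPochhammer ℂ (n+1)).eval b / ((n+1).factorial : ℂ))]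
      refine Filter.Tendsto.const_mul _ ?_
      simp only [asc_prod]
      simp only [Finset.prod_range_succ', mul_inv]
      have h1 : Filter.Tendsto (fun N : ℕ => ‖(c + (N:ℂ) + ((0:ℕ):ℂ))⁻¹‖) Filter.atTop (nhds 0) := by
        refine squeeze_zero' (Filter.Eventually.of_forall fun _ => norm_nonneg _) ?_ (tendsto_one_div_atTop_nhds_zero_nat (𝕜 := ℝ))
        filter_upwards [Filter.eventually_gt_atTop 0] with N hN
        have hNR : (0:ℝ) < N := by exact_mod_cast hN
        rw [norm_inv, ← one_div]
        gcongr
        refine le_trans ?_ (Complex.re_le_norm _)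
        simp; exact hc.le
      have h2 := tendsto_zero_iff_norm_tendsto_zero.2 h1
      refine squeeze_zero_norm (a := fun N : ℕ => ‖((ascPochhammer ℂ n).eval (c + 1))⁻¹‖ * ‖(c + (N:ℂ) + ((0:ℕ):ℂ))⁻¹‖) ?_ ?_
      · intro N
        rw [norm_mul]
        gcongr
        rw [asc_prod, norm_inv, norm_inv, norm_prod, norm_prod]
        have hc1 : 0 < (c+1).re := by simp; linarith
        refine inv_anti₀ (Finset.prod_pos fun j _ => norm_pos_iff.2 (add_nat_ne hc1 j))
          (Finset.prod_le_prod (fun _ _ => norm_nonneg _) fun j _ => ?_)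
        · rw [Nat.cast_add, Nat.cast_one]
          rw [Complex.norm_def, Complex.norm_def]
          apply Real.sqrt_le_sqrt
          simp only [Complex.normSq_apply, Complex.add_re, Complex.add_im, Complex.natCast_re, Complex.natCast_im, add_zero, Complex.one_re, Complex.one_im]
          have : (0:ℝ) ≤ N := Nat.cast_nonneg N
          have : (0:ℝ) ≤ j := Nat.cast_nonneg j
          nlinarith
      · simpa using h1.const_mul ‖((ascPochhammer ℂ n).eval (c + 1))⁻¹‖
  · refine Filter.Eventually.of_forall fun N n => ?_
    unfold hco
    rw [norm_div, norm_div, norm_div, norm_div]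
    gcongr
    · exact norm_pos_iff.2 (asc_ne hc n)
    · exact hmono N n

lemma gauss_thm (a b : ℂ) {c : ℂ} (hc : 0 < c.re) (h : 0 < (c - a - b).re)
    (ha : 0 < (c - a).re) (hb : 0 < (c - b).re) :
    hyperF a b c 1 * (Complex.Gamma (c - a) * Complex.Gamma (c - b))
      = Complex.Gamma c * Complex.Gamma (c - a - b) := by
  have L1 := ((((Complex.GammaSeq_tendsto_Gamma (c - a)).mul (Complex.GammaSeq_tendsto_Gamma (c - b)))).const_mul (hyperF a b c 1))
  have L2 := ((Complex.GammaSeq_tendsto_Gamma c).mul (Complex.GammaSeq_tendsto_Gamma (c - a - b))).mul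
    ((Filter.tendsto_add_atTop_iff_nat 1).2 (gauss_lim a b hc h))
  rw [mul_one] at L2
  refine tendsto_nhds_unique (L1.congr' ?_) L2
  filter_upwards [Filter.eventually_gt_atTop 0] with n hn
  have hn0 : n ≠ 0 := hn.ne'
  have h1 : (n : ℂ) ≠ 0 := by exact_mod_cast hn0
  have g := gauss_iter a b hc h (n + 1)
  have hp : ∀ s : ℂ, (n : ℂ) ^ s ≠ 0 := fun s => by simp [Complex.cpow_eq_zero_iff, h1]
  have h3 : (n.factorial : ℂ) ≠ 0 := by exact_mod_cast n.factorial_ne_zero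
  have G : ∀ s : ℂ, 0 < s.re → Complex.GammaSeq s n ≠ 0 := by
    intro s hs h0
    have := asc_gammaSeq_inv s n hn0
    rw [h0] at this
    exact asc_ne hs (n + 1) (by rw [this]; simp)
  have g1 := G _ hc
  have g2 := G _ h
  have g3 := G _ ha
  have g4 := G _ hb
  simp only [asc_gammaSeq_inv _ n hn0] at g
  have ee : (n:ℂ) ^ (c - a) * (n:ℂ) ^ (c - b) = (n:ℂ) ^ c * (n:ℂ) ^ (c - a - b) := by
    rw [← Complex.cpow_add _ _ h1, ← Complex.cpow_add _ _ h1]; congr 1; ring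
  have q1 := hp c
  have q2 := hp (c - a - b)
  have g' : ((n:ℂ) ^ c * (n:ℂ) ^ (c - a - b) * (n.factorial : ℂ) ^ 2) * (hyperF a b c 1 * ((Complex.GammaSeq c n)⁻¹ * (Complex.GammaSeq (c - a - b) n)⁻¹))
     = ((n:ℂ) ^ c * (n:ℂ) ^ (c - a - b) * (n.factorial : ℂ) ^ 2) * ((Complex.GammaSeq (c - a) n)⁻¹ * (Complex.GammaSeq (c - b) n)⁻¹ * hyperF a b (c + ((n + 1 : ℕ):ℂ)) 1) := by
    linear_combination g + (n.factorial : ℂ) ^ 2 * ((Complex.GammaSeq (c - a) n)⁻¹ * (Complex.GammaSeq (c - b) n)⁻¹ * hyperF a b (c + ((n + 1 : ℕ):ℂ)) 1) * ee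
  have g'' := mul_left_cancel₀ (mul_ne_zero (mul_ne_zero q1 q2) (pow_ne_zero 2 h3)) g'
  field_simp at g''
  linear_combination g''

lemma hyperF_cont (a b : ℂ) {c : ℂ} (hc : 0 < c.re) (h : 0 < (c - a - b).re) :
    ContinuousOn (hyperF a b c) (Metric.closedBall 0 1) := by
  have e : (hyperF a b c) = fun y => ∑' n, hco a b c n * y ^ n := by
    ext y; exact hyperF_eq _ _ _ _
  rw [e]
  refine continuousOn_tsum (fun n => by fun_prop) (hco_summable_one a b hc h) ?_
  intro n x hx
  have : ‖x‖ ≤ 1 := by simpa using hx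
  rw [norm_mul, norm_pow]
  exact mul_le_of_le_one_right (norm_nonneg _) (pow_le_one₀ (norm_nonneg _) this)

noncomputable def gFF (α l z : ℂ) : ℂ :=
  hyperF (1 / 4 + α / 2 + l / 2) (3 / 4 + α / 2 + l / 2) (1 + l) z

noncomputable def gPP (α l z : ℂ) : ℂ :=
  (1 / 4 + α / 2 + l / 2) * (3 / 4 + α / 2 + l / 2) / (1 + l) *
    hyperF (3 / 4 - α / 2 + l / 2) (1 / 4 - α / 2 + l / 2) (1 + l + 1) z

lemma hyperF_symm (a b c z : ℂ) : hyperF a b c z = hyperF b a c z := by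
  unfold hyperF; congr 1; ext n; ring

lemma re_one_add {l : ℂ} (hl : 0 < l.re) : 0 < (1 + l).re := by simp; linarith

lemma gFF_rel {α l z : ℂ} (hl : 0 < l.re) (hz : ‖z‖ < 1) :
    α * gFF α l z = (1 - z) ^ (-α) * gPP α l z - gPP (-α) l z := by
  have hc := re_one_add hl
  have hc1 : 0 < (1 + l + 1).re := by simp at hc ⊢; linarith
  have h0 : 1 - z ≠ 0 := Complex.slitPlane_ne_zero (one_sub_slit hz)
  have e1 := hyperF_ii (1 / 4 + α / 2 + l / 2) (3 / 4 + α / 2 + l / 2) hc hz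
  have e2 := euler_transf (1 / 4 + α / 2 + l / 2 + 1) (3 / 4 + α / 2 + l / 2 + 1) hc1 hz
  unfold gFF gPP
  rw [show 1 / 4 + α / 2 + l / 2 + 1 + (3 / 4 + α / 2 + l / 2 + 1) - (1 + l + 1) = α + 1 by ring,
    show (1 + l + 1 - (1 / 4 + α / 2 + l / 2 + 1)) = 3 / 4 - α / 2 + l / 2 by ring,
    show (1 + l + 1 - (3 / 4 + α / 2 + l / 2 + 1)) = 1 / 4 - α / 2 + l / 2 by ring] at e2
  rw [← e2, hyperF_symm (3 / 4 - -α / 2 + l / 2),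
    show 1 / 4 - -α / 2 + l / 2 = 1 / 4 + α / 2 + l / 2 by ring,
    show 3 / 4 - -α / 2 + l / 2 = 3 / 4 + α / 2 + l / 2 by ring]
  have hy : (1 - z) ^ (-α) * (1 - z) ^ (α + 1) = 1 - z := by
    rw [← Complex.cpow_add _ _ h0]; simp
  linear_combination (-1 : ℂ) * e1 - ((1 / 4 + α / 2 + l / 2) * (3 / 4 + α / 2 + l / 2) / (1 + l) *
    hyperF (1 / 4 + α / 2 + l / 2 + 1) (3 / 4 + α / 2 + l / 2 + 1) (1 + l + 1) z) * hy

lemma gFF_deriv {α l z : ℂ} (hl : 0 < l.re) (hz : ‖z‖ < 1) :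
    HasDerivAt (gFF α l) ((1 - z) ^ (-α) / (1 - z) * gPP α l z) z := by
  have hc := re_one_add hl
  have hc1 : 0 < (1 + l + 1).re := by simp at hc ⊢; linarith
  have h0 : 1 - z ≠ 0 := Complex.slitPlane_ne_zero (one_sub_slit hz)
  have e2 := euler_transf (1 / 4 + α / 2 + l / 2 + 1) (3 / 4 + α / 2 + l / 2 + 1) hc1 hz
  rw [show 1 / 4 + α / 2 + l / 2 + 1 + (3 / 4 + α / 2 + l / 2 + 1) - (1 + l + 1) = α + 1 by ring,
    show (1 + l + 1 - (1 / 4 + α / 2 + l / 2 + 1)) = 3 / 4 - α / 2 + l / 2 by ring,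
    show (1 + l + 1 - (3 / 4 + α / 2 + l / 2 + 1)) = 1 / 4 - α / 2 + l / 2 by ring] at e2
  refine (hyperF_hasDerivAt (1 / 4 + α / 2 + l / 2) (3 / 4 + α / 2 + l / 2) hc hz).congr_deriv ?_
  have hy : (1 - z) ^ (-α) * (1 - z) ^ (α + 1) = 1 - z := by
    rw [← Complex.cpow_add _ _ h0]; simp
  unfold gPP
  rw [← e2]
  have hy2 : (1 - z) ^ (-α) / (1 - z) * (1 - z) ^ (α + 1) = 1 := by
    rw [div_mul_eq_mul_div, hy, div_self h0]
  linear_combination (-1 : ℂ) * ((1 / 4 + α / 2 + l / 2) * (3 / 4 + α / 2 + l / 2) / (1 + l) *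
    hyperF (1 / 4 + α / 2 + l / 2 + 1) (3 / 4 + α / 2 + l / 2 + 1) (1 + l + 1) z) * hy2

lemma gPP_deriv {α l z : ℂ} (hl : 0 < l.re) (hz : ‖z‖ < 1) :
    ∃ P', HasDerivAt (gPP α l) P' z ∧
      z * P' = (1 / 4 + α / 2 + l / 2) * (3 / 4 + α / 2 + l / 2) * ((1 - z) ^ α * gFF α l z)
        - (1 + l) * gPP α l z := by
  have hc := re_one_add hl
  have hc1 : 0 < (1 + l + 1).re := by simp at hc ⊢; linarith
  have e2 := euler_transf (1 / 4 + α / 2 + l / 2) (3 / 4 + α / 2 + l / 2) hc hz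
  rw [show 1 / 4 + α / 2 + l / 2 + (3 / 4 + α / 2 + l / 2) - (1 + l) = α by ring,
    show (1 + l - (1 / 4 + α / 2 + l / 2)) = 3 / 4 - α / 2 + l / 2 by ring,
    show (1 + l - (3 / 4 + α / 2 + l / 2)) = 1 / 4 - α / 2 + l / 2 by ring] at e2
  have e3 := hyperF_iii (3 / 4 - α / 2 + l / 2) (1 / 4 - α / 2 + l / 2) hc hz
  refine ⟨_, (hyperF_hasDerivAt (3 / 4 - α / 2 + l / 2) (1 / 4 - α / 2 + l / 2) hc1 hz).const_mul _, ?_⟩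
  unfold gFF gPP
  rw [e2]
  have h0 := re_pos_ne hc
  have : (1 / 4 + α / 2 + l / 2) * (3 / 4 + α / 2 + l / 2) =
    (1 / 4 + α / 2 + l / 2) * (3 / 4 + α / 2 + l / 2) / (1 + l) * (1 + l) := by field_simp
  linear_combination (1 / 4 + α / 2 + l / 2) * (3 / 4 + α / 2 + l / 2) / (1 + l) * e3 -
    (hyperF (3 / 4 - α / 2 + l / 2) (1 / 4 - α / 2 + l / 2) (1 + l) z) * this

lemma gPP_cont {α l : ℂ} (hα : |α.re| < 1) (hl : 0 < l.re) :
    ContinuousOn (gPP α l) (Metric.closedBall 0 1) := by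
  have hc := re_one_add hl
  have hc1 : 0 < (1 + l + 1).re := by simp at hc ⊢; linarith
  refine continuousOn_const.mul (hyperF_cont _ _ hc1 ?_)
  rw [show 1 + l + 1 - (3 / 4 - α / 2 + l / 2) - (1 / 4 - α / 2 + l / 2) = 1 + α by ring]
  simp; linarith [(abs_lt.1 hα).1]

lemma gPP_one {α l : ℂ} (hα : |α.re| < 1) (hl : 0 < l.re) :
    gPP α l 1 = Complex.Gamma (1 + l) * Complex.Gamma (1 + α) /
      (Complex.Gamma (1 / 2 + α + l) * 2 ^ (1 / 2 - α - l) * (√π : ℝ)) := by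
  have hα1 := (abs_lt.1 hα).1
  have hα2 := (abs_lt.1 hα).2
  have hc := re_one_add hl
  have h0 := re_pos_ne hc
  have hc1 : 0 < (1 + l + 1).re := by simp at hc ⊢; linarith
  set a := 1 / 4 + α / 2 + l / 2 with ha
  set b := 3 / 4 + α / 2 + l / 2 with hb
  have hbre : 0 < b.re := by
    simp [hb]; linarith
  have hare : 0 < (a + 1).re := by
    simp [ha]; linarith
  have hb0 := re_pos_ne hbre
  have g := gauss_thm (3 / 4 - α / 2 + l / 2) (1 / 4 - α / 2 + l / 2) hc1 (by
      rw [show 1 + l + 1 - (3 / 4 - α / 2 + l / 2) - (1 / 4 - α / 2 + l / 2) = 1 + α by ring]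
      simp; linarith)
      (by rw [show 1 + l + 1 - (3 / 4 - α / 2 + l / 2) = a + 1 by rw [ha]; ring]; exact hare)
      (by rw [show 1 + l + 1 - (1 / 4 - α / 2 + l / 2) = b + 1 by rw [hb]; ring]; simp; linarith)
  rw [show 1 + l + 1 - (3 / 4 - α / 2 + l / 2) - (1 / 4 - α / 2 + l / 2) = 1 + α by ring,
    show 1 + l + 1 - (3 / 4 - α / 2 + l / 2) = a + 1 by rw [ha]; ring,
    show 1 + l + 1 - (1 / 4 - α / 2 + l / 2) = b + 1 by rw [hb]; ring] at g
  have dup := Complex.Gamma_mul_Gamma_add_half a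
  rw [show a + 1 / 2 = b by rw [ha, hb]; ring, show 2 * a = 1 / 2 + α + l by rw [ha]; ring,
    show 1 - (1 / 2 + α + l) = 1 / 2 - α - l by ring] at dup
  rw [← dup]
  unfold gPP
  rw [← ha, ← hb]
  rw [Complex.Gamma_add_one _ h0, Complex.Gamma_add_one _ hb0] at g
  by_cases ha0 : a = 0
  · simp [ha0]
  rw [Complex.Gamma_add_one _ ha0] at g
  have hG1 : Complex.Gamma b ≠ 0 := Complex.Gamma_ne_zero_of_re_pos hbre
  have hG2 : Complex.Gamma a ≠ 0 := by
    have := Complex.Gamma_ne_zero_of_re_pos hare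
    rw [Complex.Gamma_add_one _ ha0] at this
    exact right_ne_zero_of_mul this
  generalize hyperF (3 / 4 - α / 2 + l / 2) (1 / 4 - α / 2 + l / 2) (1 + l + 1) 1 = X at g ⊢
  clear_value a b
  field_simp
  linear_combination g

noncomputable def gH (α l₁ l₂ z : ℂ) : ℂ :=
  (l₂ - l₁) * ((1 - z) * (1 - z) ^ α) * (gFF α l₁ z * gFF α l₂ z)
    + 2 * z * (gFF α l₁ z * gPP α l₂ z - gPP α l₁ z * gFF α l₂ z)

lemma gH_deriv {α l₁ l₂ z : ℂ} (h₁ : 0 < l₁.re) (h₂ : 0 < l₂.re) (hz : ‖z‖ < 1) :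
    ∃ H', HasDerivAt (gH α l₁ l₂) H' z ∧
      -(l₁ + l₂) * gH α l₁ l₂ z - 2 * z * H' =
        (l₁ ^ 2 - l₂ ^ 2) * ((1 - z) ^ α * (gFF α l₁ z * gFF α l₂ z)) := by
  have hsl := one_sub_slit hz
  have h0 : 1 - z ≠ 0 := Complex.slitPlane_ne_zero hsl
  have hx : HasDerivAt (fun y : ℂ => 1 - y) (-1) z := by
    simpa using (hasDerivAt_id z).const_sub 1
  obtain ⟨P1, hP1, eP1⟩ := gPP_deriv (α := α) h₁ hz
  obtain ⟨P2, hP2, eP2⟩ := gPP_deriv (α := α) h₂ hz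
  have hF1 := gFF_deriv (α := α) h₁ hz
  have hF2 := gFF_deriv (α := α) h₂ hz
  have hxy := hx.mul (hx.cpow_const (c := α) hsl)
  have D := ((hxy.const_mul (l₂ - l₁)).mul (hF1.mul hF2)).add
    (((hasDerivAt_id z).const_mul 2).mul ((hF1.mul hP2).sub (hP1.mul hF2)))
  refine ⟨_, D, ?_⟩
  simp only [id, Pi.mul_apply, Pi.sub_apply]
  unfold gH
  have hy0 : (1 - z) ^ α ≠ 0 := by simp [Complex.cpow_eq_zero_iff, h0]
  have y1 : (1 - z) ^ (α - 1) = (1 - z) ^ α / (1 - z) := by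
    rw [Complex.cpow_sub _ _ h0, Complex.cpow_one]
  rw [y1, Complex.cpow_neg]
  generalize (1 - z) ^ α = y at *
  generalize gFF α l₁ z = F1 at *
  generalize gFF α l₂ z = F2 at *
  generalize gPP α l₁ z = p1 at *
  generalize gPP α l₂ z = p2 at *
  have hv : (1 - z) * (y / (1 - z)) = y := by field_simp
  have ht : (1 - z) * y * (y⁻¹ / (1 - z)) = 1 := by field_simp
  generalize y⁻¹ / (1 - z) = t at *
  generalize y / (1 - z) = v at *
  linear_combination 2 * z * α * (l₂ - l₁) * F1 * F2 * hv
    - 2 * z * (l₂ - l₁) * (p1 * F2 + F1 * p2) * ht - 4 * z * F1 * eP2 + 4 * z * F2 * eP1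

noncomputable def gHB (α l₁ l₂ : ℂ) (t : ℝ) : ℂ :=
  (l₂ - l₁) / α ^ 2 * (((1 - t : ℝ) : ℂ) ^ (1 - α) * (gPP α l₁ t * gPP α l₂ t)
      - (1 - t) * (gPP α l₁ t * gPP (-α) l₂ t + gPP (-α) l₁ t * gPP α l₂ t)
      + ((1 - t : ℝ) : ℂ) ^ (1 + α) * (gPP (-α) l₁ t * gPP (-α) l₂ t))
    - 2 * t / α * (gPP (-α) l₁ t * gPP α l₂ t - gPP α l₁ t * gPP (-α) l₂ t)

noncomputable def gK (α l₁ l₂ : ℂ) (t : ℝ) : ℂ :=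
  1 / α ^ 2 * (((1 - t : ℝ) : ℂ) ^ (-α) * (gPP α l₁ t * gPP α l₂ t)
      - (gPP α l₁ t * gPP (-α) l₂ t + gPP (-α) l₁ t * gPP α l₂ t)
      + ((1 - t : ℝ) : ℂ) ^ α * (gPP (-α) l₁ t * gPP (-α) l₂ t))

lemma norm_t {t : ℝ} (h0 : 0 ≤ t) (h1 : t < 1) : ‖(t : ℂ)‖ < 1 := by
  rw [Complex.norm_real, Real.norm_of_nonneg h0]; exact h1

lemma gFF_eq {α l : ℂ} (hα0 : α ≠ 0) (hl : 0 < l.re) {t : ℝ} (h0 : 0 ≤ t) (h1 : t < 1) :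
    gFF α l t = (((1 - t : ℝ) : ℂ) ^ (-α) * gPP α l t - gPP (-α) l t) / α := by
  have := gFF_rel (α := α) hl (norm_t h0 h1)
  push_cast
  rw [← this]; field_simp

lemma gH_eq {α l₁ l₂ : ℂ} (hα0 : α ≠ 0) (h₁ : 0 < l₁.re) (h₂ : 0 < l₂.re) {t : ℝ}
    (h0 : 0 ≤ t) (h1 : t < 1) : gH α l₁ l₂ t = gHB α l₁ l₂ t := by
  unfold gH gHB
  rw [gFF_eq hα0 h₁ h0 h1, gFF_eq hα0 h₂ h0 h1]
  have hx : ((1 - t : ℝ) : ℂ) ≠ 0 := by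
    have : (1 - t : ℝ) ≠ 0 := by linarith
    exact_mod_cast this
  have hy0 : ((1 - t : ℝ) : ℂ) ^ α ≠ 0 := by simp only [ne_eq, Complex.cpow_eq_zero_iff, hx, false_and, not_false_eq_true]
  rw [sub_eq_add_neg 1 α, Complex.cpow_add _ _ hx, Complex.cpow_add _ _ hx, Complex.cpow_one, Complex.cpow_neg]
  rw [show (1 - (t:ℂ)) = ((1 - t : ℝ) : ℂ) by push_cast; rfl]
  generalize ((1 - t : ℝ) : ℂ) ^ α = y at *
  field_simp
  ring

lemma gK_eq {α l₁ l₂ : ℂ} (hα0 : α ≠ 0) (h₁ : 0 < l₁.re) (h₂ : 0 < l₂.re) {t : ℝ}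
    (h0 : 0 ≤ t) (h1 : t < 1) :
    ((1 - t : ℝ) : ℂ) ^ α * (gFF α l₁ t * gFF α l₂ t) = gK α l₁ l₂ t := by
  unfold gK
  rw [gFF_eq hα0 h₁ h0 h1, gFF_eq hα0 h₂ h0 h1]
  have hx : ((1 - t : ℝ) : ℂ) ≠ 0 := by
    have : (1 - t : ℝ) ≠ 0 := by linarith
    exact_mod_cast this
  have hy0 : ((1 - t : ℝ) : ℂ) ^ α ≠ 0 := by simp only [ne_eq, Complex.cpow_eq_zero_iff, hx, false_and, not_false_eq_true]
  rw [Complex.cpow_neg]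
  generalize ((1 - t : ℝ) : ℂ) ^ α = y at *
  field_simp
  ring

lemma gPP_contR {α l : ℂ} (hα : |α.re| < 1) (hl : 0 < l.re) :
    ContinuousOn (fun t : ℝ => gPP α l t) (Icc 0 1) := by
  refine (gPP_cont hα hl).comp Complex.continuous_ofReal.continuousOn ?_
  intro t ht
  simp [abs_of_nonneg ht.1, ht.2]

lemma cpow_contR {s : ℂ} {S : Set ℝ} (h : 0 < s.re ∨ ∀ t ∈ S, t < 1) :
    ContinuousOn (fun t : ℝ => ((1 - t : ℝ) : ℂ) ^ s) S := by
  intro t ht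
  refine ContinuousAt.continuousWithinAt ?_
  have := Complex.continuousAt_ofReal_cpow_const (1 - t) s (h.imp id fun h => by linarith [h t ht])
  exact ContinuousAt.comp (f := fun t : ℝ => 1 - t) (g := fun x : ℝ => (x : ℂ) ^ s) this (by fun_prop)

lemma gHB_cont {α l₁ l₂ : ℂ} (hα : |α.re| < 1) (h₁ : 0 < l₁.re) (h₂ : 0 < l₂.re) :
    ContinuousOn (gHB α l₁ l₂) (Icc 0 1) := by
  have hα' : |(-α).re| < 1 := by simpa using hα
  have a1 := gPP_contR hα h₁
  have a2 := gPP_contR hα h₂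
  have b1 := gPP_contR hα' h₁
  have b2 := gPP_contR hα' h₂
  have c1 : ContinuousOn (fun t : ℝ => ((1 - t : ℝ) : ℂ) ^ (1 - α)) (Icc 0 1) :=
    cpow_contR (Or.inl (by simp; linarith [(abs_lt.1 hα).2]))
  have c2 : ContinuousOn (fun t : ℝ => ((1 - t : ℝ) : ℂ) ^ (1 + α)) (Icc 0 1) :=
    cpow_contR (Or.inl (by simp; linarith [(abs_lt.1 hα).1]))
  have d1 : ContinuousOn (fun t : ℝ => (t : ℂ)) (Icc 0 1) := Complex.continuous_ofReal.continuousOn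
  unfold gHB
  refine ContinuousOn.sub (continuousOn_const.mul ((((c1.mul (a1.mul a2))).sub ((continuousOn_const.sub d1).mul ((a1.mul b2).add (b1.mul a2)))).add (c2.mul (b1.mul b2)))) (((continuousOn_const.mul d1).div_const _).mul ((b1.mul a2).sub (a1.mul b2)))

lemma gK_cont {α l₁ l₂ : ℂ} (hα : |α.re| < 1) (h₁ : 0 < l₁.re) (h₂ : 0 < l₂.re) :
    ContinuousOn (gK α l₁ l₂) (Ico 0 1) := by
  have hα' : |(-α).re| < 1 := by simpa using hα
  have a1 := (gPP_contR hα h₁).mono Ico_subset_Icc_self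
  have a2 := (gPP_contR hα h₂).mono Ico_subset_Icc_self
  have b1 := (gPP_contR hα' h₁).mono Ico_subset_Icc_self
  have b2 := (gPP_contR hα' h₂).mono Ico_subset_Icc_self
  have c1 : ContinuousOn (fun t : ℝ => ((1 - t : ℝ) : ℂ) ^ (-α)) (Ico 0 1) :=
    cpow_contR (Or.inr fun t ht => ht.2)
  have c2 : ContinuousOn (fun t : ℝ => ((1 - t : ℝ) : ℂ) ^ α) (Ico 0 1) :=
    cpow_contR (Or.inr fun t ht => ht.2)
  unfold gK
  exact continuousOn_const.mul ((((c1.mul (a1.mul a2))).sub (((a1.mul b2).add (b1.mul a2)))).add (c2.mul (b1.mul b2)))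

lemma gPP_bdd {α l : ℂ} (hα : |α.re| < 1) (hl : 0 < l.re) :
    ∃ M : ℝ, 0 ≤ M ∧ ∀ t ∈ Icc (0:ℝ) 1, ‖gPP α l t‖ ≤ M := by
  obtain ⟨M, hM⟩ := isCompact_Icc.exists_bound_of_continuousOn (gPP_contR hα hl)
  exact ⟨M, (norm_nonneg _).trans (hM 0 (by simp)), hM⟩

lemma gK_bdd {α l₁ l₂ : ℂ} (hα : |α.re| < 1) (h₁ : 0 < l₁.re) (h₂ : 0 < l₂.re) :
    ∃ M : ℝ, 0 ≤ M ∧ ∀ t ∈ Ico (0:ℝ) 1, ‖gK α l₁ l₂ t‖ ≤ M * (1 - t) ^ (-|α.re|) := by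
  have hα' : |(-α).re| < 1 := by simpa using hα
  obtain ⟨A, hA, HA⟩ := gPP_bdd hα h₁
  obtain ⟨B, hB, HB⟩ := gPP_bdd hα h₂
  obtain ⟨C, hC, HC⟩ := gPP_bdd hα' h₁
  obtain ⟨D, hD, HD⟩ := gPP_bdd hα' h₂
  refine ⟨‖1 / α ^ 2‖ * (A * B + (A * D + C * B) + C * D), by positivity, ?_⟩
  intro t ht
  have ht' := Ico_subset_Icc_self ht
  have hx0 : 0 < 1 - t := by linarith [ht.2]
  have hx1 : 1 - t ≤ 1 := by linarith [ht.1]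
  have e : ∀ s : ℝ, -|α.re| ≤ s → (1 - t) ^ s ≤ (1 - t) ^ (-|α.re|) := fun s hs =>
    Real.rpow_le_rpow_of_exponent_ge hx0 hx1 hs
  have n1 : ‖((1 - t : ℝ) : ℂ) ^ (-α)‖ ≤ (1 - t) ^ (-|α.re|) := by
    rw [Complex.norm_cpow_eq_rpow_re_of_pos hx0]; exact e _ (by simp [le_abs_self])
  have n2 : ‖((1 - t : ℝ) : ℂ) ^ α‖ ≤ (1 - t) ^ (-|α.re|) := by
    rw [Complex.norm_cpow_eq_rpow_re_of_pos hx0]; exact e _ (neg_abs_le _)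
  have n3 : 1 ≤ (1 - t) ^ (-|α.re|) := by simpa using e 0 (by simp)
  unfold gK
  rw [norm_mul, mul_assoc]
  gcongr
  refine (norm_add_le _ _).trans ?_
  refine (add_le_add_left (norm_sub_le _ _) _).trans ?_
  have k1 : ‖((1 - t : ℝ) : ℂ) ^ (-α) * (gPP α l₁ t * gPP α l₂ t)‖ ≤ (1 - t) ^ (-|α.re|) * (A * B) := by
    rw [norm_mul, norm_mul]; gcongr
    · exact HA t ht'
    · exact HB t ht'
  have k2 : ‖((1 - t : ℝ) : ℂ) ^ α * (gPP (-α) l₁ t * gPP (-α) l₂ t)‖ ≤ (1 - t) ^ (-|α.re|) * (C * D) := by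
    rw [norm_mul, norm_mul]; gcongr
    · exact HC t ht'
    · exact HD t ht'
  have k3 : ‖gPP α l₁ t * gPP (-α) l₂ t + gPP (-α) l₁ t * gPP α l₂ t‖ ≤ A * D + C * B := by
    refine (norm_add_le _ _).trans ?_
    rw [norm_mul, norm_mul]
    gcongr
    · exact HA t ht'
    · exact HD t ht'
    · exact HC t ht'
    · exact HB t ht'
  have k4 : A * D + C * B ≤ (A * D + C * B) * (1 - t) ^ (-|α.re|) := le_mul_of_one_le_right (by positivity) n3
  linarith

lemma bound_integrable {r Λ : ℝ} (hr0 : 0 ≤ r) (hr : r < 1) (hΛ : 0 < Λ) :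
    IntegrableOn (fun w : ℝ => w ^ (-1 - Λ) * (1 - 1 / w ^ 2) ^ (-r)) (Ioi 1) := by
  have hx : ∀ w : ℝ, 1 < w → 0 < 1 - 1 / w ^ 2 := by
    intro w hw
    have : 1 / w ^ 2 < 1 := by rw [div_lt_one (by positivity)]; nlinarith
    linarith
  have I1 : IntegrableOn (fun w : ℝ => 2 / w ^ 3 * (1 - r) * (1 - 1 / w ^ 2) ^ (-r)) (Ioi 1) := by
    refine integrableOn_Ioi_deriv_of_nonneg (g := fun w : ℝ => (1 - 1 / w ^ 2) ^ (1 - r)) (l := 1) ?_ ?_ ?_ ?_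
    · have : ContinuousAt (fun w : ℝ => (1 - 1 / w ^ 2) ^ (1 - r)) 1 := by
        refine ContinuousAt.rpow_const ?_ (Or.inr (by linarith))
        refine continuousAt_const.sub (continuousAt_const.div (by fun_prop) (by norm_num))
      exact this.continuousWithinAt
    · intro w hw
      have hw0 : (0:ℝ) < w := lt_trans one_pos hw
      have d : HasDerivAt (fun w : ℝ => 1 - 1 / w ^ 2) (2 / w ^ 3) w := by
        have := (((hasDerivAt_pow 2 w).inv (by positivity))).const_sub 1
        simp only [one_div]
        refine this.congr_deriv ?_
        field_simp
        simp [mul_comm]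
      refine (d.rpow_const (p := 1 - r) (Or.inl (hx w hw).ne')).congr_deriv ?_
      rw [show 1 - r - 1 = -r by ring]
    · intro w hw
      have := hx w hw
      have hw0 : (0:ℝ) < w := lt_trans one_pos hw
      have : 0 ≤ 1 - r := by linarith
      positivity
    · have h1 : Filter.Tendsto (fun w : ℝ => 1 - 1 / w ^ 2) Filter.atTop (nhds 1) := by
        have := (tendsto_const_nhds (x := (1:ℝ))).div_atTop (Filter.tendsto_pow_atTop (α := ℝ) (n := 2) (by norm_num))
        simpa using this.const_sub 1
      have := h1.rpow_const (p := 1 - r) (Or.inl one_ne_zero)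
      simpa using this
  have I2 : IntegrableOn (fun w : ℝ => w ^ (-1 - Λ)) (Ioi 1) :=
    integrableOn_Ioi_rpow_of_lt (by linarith) one_pos
  have I3 := (I1.const_mul (4 / (1 - r))).add (I2.const_mul 2)
  refine I3.mono' ?_ ?_
  · refine ContinuousOn.aestronglyMeasurable ?_ measurableSet_Ioi
    intro w hw
    have hw0 : (0:ℝ) < w := lt_trans one_pos hw
    refine ContinuousAt.continuousWithinAt (ContinuousAt.mul (ContinuousAt.rpow_const continuousAt_id (Or.inl hw0.ne')) ?_)
    refine ContinuousAt.rpow_const ?_ (Or.inl (hx w hw).ne')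
    exact continuousAt_const.sub (continuousAt_const.div (by fun_prop) (by positivity))
  · refine (ae_restrict_iff' measurableSet_Ioi).2 (Filter.Eventually.of_forall fun w hw => ?_)
    have hw1 : (1:ℝ) < w := hw
    have hw0 : (0:ℝ) < w := lt_trans one_pos hw
    have hx0 := hx w hw
    have h1r : 0 < 1 - r := by linarith
    rw [Real.norm_of_nonneg (by positivity)]
    simp only [Pi.add_apply]
    rw [show 4 / (1 - r) * (2 / w ^ 3 * (1 - r) * (1 - 1 / w ^ 2) ^ (-r)) = 8 / w ^ 3 * (1 - 1 / w ^ 2) ^ (-r) by field_simp; ring]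
    rcases le_or_gt w 2 with h2 | h2
    · have : w ^ (-1 - Λ) ≤ 8 / w ^ 3 := by
        have a1 : w ^ (-1 - Λ) ≤ 1 := Real.rpow_le_one_of_one_le_of_nonpos hw1.le (by linarith)
        have a2 : 1 ≤ 8 / w ^ 3 := by
          rw [le_div_iff₀ (by positivity), one_mul]
          calc w ^ 3 ≤ 2 ^ 3 := by gcongr
            _ = 8 := by norm_num
        linarith
      have b := mul_le_mul_of_nonneg_right this (by positivity : 0 ≤ (1 - 1 / w ^ 2) ^ (-r))
      have : 0 ≤ 2 * w ^ (-1 - Λ) := by positivity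
      linarith
    · have h3 : 1 / 2 ≤ 1 - 1 / w ^ 2 := by
        have : 1 / w ^ 2 ≤ 1 / 2 := by
          apply one_div_le_one_div_of_le (by norm_num); nlinarith
        linarith
      have : (1 - 1 / w ^ 2) ^ (-r) ≤ 2 := by
        calc (1 - 1 / w ^ 2) ^ (-r) ≤ (1 / 2 : ℝ) ^ (-r) :=
              Real.rpow_le_rpow_of_nonpos (by norm_num) h3 (by linarith)
          _ ≤ (1 / 2 : ℝ) ^ (-1 : ℝ) := Real.rpow_le_rpow_of_exponent_ge (by norm_num) (by norm_num) (by linarith)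
          _ = 2 := by rw [Real.rpow_neg_one]; norm_num
      have b := mul_le_mul_of_nonneg_left this (by positivity : 0 ≤ w ^ (-1 - Λ))
      have : 0 ≤ 8 / w ^ 3 * (1 - 1 / w ^ 2) ^ (-r) := by positivity
      linarith

lemma inv_sq_mem {w : ℝ} (hw : 1 < w) : 1 / w ^ 2 ∈ Ioo (0:ℝ) 1 := by
  have : 0 < w := by linarith
  refine ⟨by positivity, ?_⟩
  rw [div_lt_one (by positivity)]; nlinarith

lemma gV_deriv {α l₁ l₂ : ℂ} (hα0 : α ≠ 0) (h₁ : 0 < l₁.re) (h₂ : 0 < l₂.re) {w : ℝ} (hw : 1 < w) :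
    HasDerivAt (fun w : ℝ => (w : ℂ) ^ (-(l₁ + l₂)) * gHB α l₁ l₂ (1 / w ^ 2))
      ((l₁ ^ 2 - l₂ ^ 2) * ((w : ℂ) ^ (-1 - (l₁ + l₂)) * gK α l₁ l₂ (1 / w ^ 2))) w := by
  have ht := inv_sq_mem hw
  have hw0 : 0 < w := by linarith
  have hwc : (w : ℂ) ≠ 0 := by exact_mod_cast hw0.ne'
  have hz : ‖(1 / (w : ℂ) ^ 2)‖ < 1 := by
    have := norm_t ht.1.le ht.2
    push_cast at this; exact this
  obtain ⟨H', hH, eH⟩ := gH_deriv (α := α) h₁ h₂ hz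
  have d : HasDerivAt (fun y : ℂ => 1 / y ^ 2) (-2 / (w : ℂ) ^ 3) (w : ℂ) := by
    have := ((hasDerivAt_pow 2 (w : ℂ)).inv (pow_ne_zero 2 hwc))
    simp only [one_div]
    refine this.congr_deriv ?_
    field_simp
    simp [mul_comm]
  have hp : HasDerivAt (fun y : ℂ => y ^ (-(l₁ + l₂))) (-(l₁ + l₂) * (w : ℂ) ^ (-(l₁ + l₂) - 1) * 1) (w : ℂ) :=
    (hasDerivAt_id _).cpow_const (Or.inl (by simpa using hw0))
  have hcomp := HasDerivAt.comp (w : ℂ) (h := fun y : ℂ => 1 / y ^ 2) hH d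
  have D := (hp.mul hcomp).comp_ofReal
  have ee : (fun w : ℝ => (w : ℂ) ^ (-(l₁ + l₂)) * gHB α l₁ l₂ (1 / w ^ 2)) =ᶠ[nhds w]
      fun y : ℝ => ((fun y : ℂ => y ^ (-(l₁ + l₂))) * (gH α l₁ l₂ ∘ fun y : ℂ => 1 / y ^ 2)) (y : ℂ) := by
    filter_upwards [lt_mem_nhds hw] with y hy
    have hy' := inv_sq_mem hy
    simp only [Pi.mul_apply, Function.comp]
    rw [← gH_eq hα0 h₁ h₂ hy'.1.le hy'.2]
    push_cast; rfl
  refine (D.congr_of_eventuallyEq ee).congr_deriv ?_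
  rw [← gK_eq hα0 h₁ h₂ ht.1.le ht.2]
  simp only [Function.comp]
  push_cast
  rw [mul_left_comm (l₁ ^ 2 - l₂ ^ 2), ← eH, show -(l₁ + l₂) - 1 = -1 - (l₁ + l₂) by ring]
  have e1 : (w : ℂ) ^ (-(l₁ + l₂)) = (w : ℂ) ^ (-1 - (l₁ + l₂)) * w := by
    rw [show -(l₁ + l₂) = (-1 - (l₁ + l₂)) + 1 by ring, Complex.cpow_add _ _ hwc, Complex.cpow_one]
  rw [e1]
  field_simp
  ring

lemma gInt {α l₁ l₂ : ℂ} (hα : |α.re| < 1) (h₁ : 0 < l₁.re) (h₂ : 0 < l₂.re) :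
    IntegrableOn (fun w : ℝ => (w : ℂ) ^ (-1 - (l₁ + l₂)) * gK α l₁ l₂ (1 / w ^ 2)) (Ioi 1) := by
  obtain ⟨M, hM, HM⟩ := gK_bdd hα h₁ h₂
  have B := (bound_integrable (abs_nonneg α.re) hα (show 0 < (l₁ + l₂).re by simp; linarith)).const_mul M
  refine B.mono' ?_ ?_
  · refine ContinuousOn.aestronglyMeasurable ?_ measurableSet_Ioi
    refine ContinuousOn.mul ?_ ?_
    · intro w hw
      have hw0 : (0:ℝ) < w := lt_trans one_pos hw
      exact (Complex.continuousAt_ofReal_cpow_const w _ (Or.inr hw0.ne')).continuousWithinAt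
    · refine (gK_cont hα h₁ h₂).comp (f := fun w : ℝ => 1 / w ^ 2) ?_ ?_
      · intro w hw
        have hw0 : (0:ℝ) < w := lt_trans one_pos hw
        exact (continuousAt_const.div (by fun_prop) (by positivity)).continuousWithinAt
      · intro w hw
        exact Ioo_subset_Ico_self (inv_sq_mem hw)
  · refine (ae_restrict_iff' measurableSet_Ioi).2 (Filter.Eventually.of_forall fun w hw => ?_)
    have hw0 : (0:ℝ) < w := lt_trans one_pos hw
    rw [norm_mul, Complex.norm_cpow_eq_rpow_re_of_pos hw0]
    have := HM _ (Ioo_subset_Ico_self (inv_sq_mem hw))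
    rw [show (-1 - (l₁ + l₂)).re = -1 - (l₁ + l₂).re by simp]
    calc _ ≤ w ^ (-1 - (l₁ + l₂).re) * (M * (1 - 1 / w ^ 2) ^ (-|α.re|)) := by gcongr
      _ = _ := by ring

lemma gMain {α l₁ l₂ : ℂ} (hα : |α.re| < 1) (hα0 : α ≠ 0) (h₁ : 0 < l₁.re) (h₂ : 0 < l₂.re) :
    (l₁ ^ 2 - l₂ ^ 2) * ∫ w in Ioi (1:ℝ), (w : ℂ) ^ (-1 - (l₁ + l₂)) * gK α l₁ l₂ (1 / w ^ 2)
      = 2 / α * (gPP (-α) l₁ 1 * gPP α l₂ 1 - gPP α l₁ 1 * gPP (-α) l₂ 1) := by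
  rw [← integral_const_mul]
  have hmem : ∀ w ∈ Ici (1:ℝ), 1 / w ^ 2 ∈ Icc (0:ℝ) 1 := by
    intro w hw
    have hw1 : (1:ℝ) ≤ w := hw
    refine ⟨by positivity, ?_⟩
    rw [div_le_one (by positivity)]; nlinarith
  have hc : ContinuousWithinAt (fun w : ℝ => (w : ℂ) ^ (-(l₁ + l₂)) * gHB α l₁ l₂ (1 / w ^ 2)) (Ici 1) 1 := by
    refine ContinuousWithinAt.mul ?_ ?_
    · exact (Complex.continuousAt_ofReal_cpow_const 1 _ (Or.inr one_ne_zero)).continuousWithinAt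
    · refine ((gHB_cont hα h₁ h₂).comp (f := fun w : ℝ => 1 / w ^ 2) (s := Ici 1) ?_ hmem) 1 (by simp)
      intro w hw
      have hw0 : (0:ℝ) < w := lt_of_lt_of_le one_pos hw
      exact (continuousAt_const.div (by fun_prop) (by positivity)).continuousWithinAt
  have hlim : Filter.Tendsto (fun w : ℝ => (w : ℂ) ^ (-(l₁ + l₂)) * gHB α l₁ l₂ (1 / w ^ 2)) Filter.atTop (nhds 0) := by
    have t1 : Filter.Tendsto (fun w : ℝ => (w : ℂ) ^ (-(l₁ + l₂))) Filter.atTop (nhds 0) := by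
      rw [tendsto_zero_iff_norm_tendsto_zero]
      have := tendsto_rpow_neg_atTop (show 0 < (l₁ + l₂).re by simp; linarith)
      refine this.congr' ?_
      filter_upwards [Filter.eventually_gt_atTop 0] with w hw
      rw [Complex.norm_cpow_eq_rpow_re_of_pos hw]; simp
    have t2 : Filter.Tendsto (fun w : ℝ => gHB α l₁ l₂ (1 / w ^ 2)) Filter.atTop (nhds (gHB α l₁ l₂ 0)) := by
      have c := (gHB_cont hα h₁ h₂) 0 (by simp)
      refine Filter.Tendsto.comp (y := nhdsWithin 0 (Icc 0 1)) c ?_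
      refine tendsto_nhdsWithin_iff.2 ⟨?_, ?_⟩
      · exact (tendsto_const_nhds (x := (1:ℝ))).div_atTop (Filter.tendsto_pow_atTop (α := ℝ) (n := 2) (by norm_num))
      · filter_upwards [Filter.eventually_ge_atTop 1] with w hw
        exact hmem w hw
    simpa using t1.mul t2
  rw [integral_Ioi_of_hasDerivAt_of_tendsto hc (fun w hw => gV_deriv hα0 h₁ h₂ hw)
    ((gInt hα h₁ h₂).const_mul _) hlim]
  have z1 : (1 : ℂ) - α ≠ 0 := re_pos_ne (by simp; linarith [(abs_lt.1 hα).2])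
  have z2 : (1 : ℂ) + α ≠ 0 := re_pos_ne (by simp; linarith [(abs_lt.1 hα).1])
  simp only [gHB]
  norm_num [Complex.zero_cpow z1, Complex.zero_cpow z2]

lemma integrand_eq {α l₁ l₂ : ℂ} (hα0 : α ≠ 0) (h₁ : 0 < l₁.re) (h₂ : 0 < l₂.re)
    {w : ℝ} (hw : 1 < w) :
    gegenbauerZ α l₁ w * gegenbauerZ α l₂ w * ((w : ℂ) ^ 2 - 1) ^ α * 2 =
      2 / (Complex.Gamma (1 + l₁) * Complex.Gamma (1 + l₂)) *
        ((w : ℂ) ^ (-1 - (l₁ + l₂)) * gK α l₁ l₂ (1 / w ^ 2)) := by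
  have ht := inv_sq_mem hw
  have hw0 : 0 < w := by linarith
  have hwc : (w : ℂ) ≠ 0 := by exact_mod_cast hw0.ne'
  rw [← gK_eq hα0 h₁ h₂ ht.1.le ht.2]
  have e : ((w : ℂ) ^ 2 - 1) ^ α = (w : ℂ) ^ (2 * α) * ((1 - 1 / w ^ 2 : ℝ) : ℂ) ^ α := by
    have : ((w : ℂ) ^ 2 - 1) = ((w * w : ℝ) : ℂ) * ((1 - 1 / w ^ 2 : ℝ) : ℂ) := by
      push_cast; field_simp
    rw [this, Complex.mul_cpow_ofReal_nonneg (by positivity) (by linarith [ht.2])]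
    congr 1
    push_cast
    rw [Complex.mul_cpow_ofReal_nonneg hw0.le hw0.le, two_mul, Complex.cpow_add _ _ hwc]
  have e2 : (w : ℂ) ^ (-(1 / 2 : ℂ) - α - l₁) * (w : ℂ) ^ (-(1 / 2 : ℂ) - α - l₂) * (w : ℂ) ^ (2 * α)
      = (w : ℂ) ^ (-1 - (l₁ + l₂)) := by
    rw [← Complex.cpow_add _ _ hwc, ← Complex.cpow_add _ _ hwc]; congr 1; ring
  rw [e, ← e2]
  unfold gegenbauerZ gFF
  rw [add_comm l₁ 1, add_comm l₂ 1]
  push_cast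
  simp only [div_eq_mul_inv, mul_inv]
  ring

theorem bilinear_integral_gegenbauerZ (α lam₁ lam₂ : ℂ)
    (hα : |α.re| < 1) (hα0 : α ≠ 0)
    (h₁ : 0 < lam₁.re) (h₂ : 0 < lam₂.re) (hne : lam₁ ^ 2 ≠ lam₂ ^ 2) :
    (∫ w in Ioi (1:ℝ),
        gegenbauerZ α lam₁ w * gegenbauerZ α lam₂ w * ((w : ℂ) ^ 2 - 1) ^ α * 2)
      = (2 ^ (lam₁ + lam₂ + 1) / ((lam₁ ^ 2 - lam₂ ^ 2) * Complex.sin ((π : ℂ) * α)))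
          * (1 / (Complex.Gamma (1 / 2 - α + lam₁) * Complex.Gamma (1 / 2 + α + lam₂))
             - 1 / (Complex.Gamma (1 / 2 - α + lam₂) * Complex.Gamma (1 / 2 + α + lam₁))) := by
  have hα' : |(-α).re| < 1 := by simpa using hα
  rw [setIntegral_congr_fun measurableSet_Ioi
    (fun w hw => integrand_eq hα0 h₁ h₂ (show 1 < w from hw)), integral_const_mul]
  have M := gMain hα hα0 h₁ h₂
  set I := ∫ w in Ioi (1:ℝ), (w : ℂ) ^ (-1 - (lam₁ + lam₂)) * gK α lam₁ lam₂ (1 / w ^ 2)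
  have hk : lam₁ ^ 2 - lam₂ ^ 2 ≠ 0 := sub_ne_zero.2 hne
  have hI : I = (2 / α * (gPP (-α) lam₁ 1 * gPP α lam₂ 1 - gPP α lam₁ 1 * gPP (-α) lam₂ 1)) / (lam₁ ^ 2 - lam₂ ^ 2) := by
    rw [← M]; field_simp
  rw [hI, gPP_one hα h₁, gPP_one hα h₂, gPP_one hα' h₁, gPP_one hα' h₂]
  have G1 : Complex.Gamma (1 + lam₁) ≠ 0 := Complex.Gamma_ne_zero_of_re_pos (re_one_add h₁)
  have G2 : Complex.Gamma (1 + lam₂) ≠ 0 := Complex.Gamma_ne_zero_of_re_pos (re_one_add h₂)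
  have hrefl : Complex.Gamma (1 + α) * Complex.Gamma (1 + -α) = α * (π / Complex.sin (π * α)) := by
    rw [← Complex.Gamma_mul_Gamma_one_sub, add_comm 1 α, Complex.Gamma_add_one _ hα0, ← sub_eq_add_neg]; ring
  have hpi : ((√π : ℝ) : ℂ) * ((√π : ℝ) : ℂ) = (π : ℂ) := by
    rw [← Complex.ofReal_mul, Real.mul_self_sqrt Real.pi_pos.le]
  have hpi0 : (π : ℂ) ≠ 0 := by exact_mod_cast Real.pi_ne_zero
  have two0 : (2 : ℂ) ≠ 0 := two_ne_zero
  have pw : ∀ x y : ℂ, (2 ^ (1 / 2 - -α - x) : ℂ)⁻¹ * (2 ^ (1 / 2 - α - y) : ℂ)⁻¹ * 2 * 2 = 2 ^ (x + y + 1) := by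
    intro x y
    have h2 : (2:ℂ) ^ (x + y + 1) = 2 ^ (-(1 / 2 - -α - x)) * 2 ^ (-(1 / 2 - α - y)) * 2 ^ (1:ℂ) * 2 ^ (1:ℂ) := by
      rw [← Complex.cpow_add _ _ two0, ← Complex.cpow_add _ _ two0, ← Complex.cpow_add _ _ two0]
      congr 1; ring
    rw [h2, Complex.cpow_one, Complex.cpow_neg, Complex.cpow_neg]
  have p1 := pw lam₁ lam₂
  have p2 := pw lam₂ lam₁
  rw [add_comm lam₂ lam₁] at p2
  have s1 : ((√π : ℝ) : ℂ)⁻¹ * ((√π : ℝ) : ℂ)⁻¹ * π = 1 := by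
    rw [← mul_inv, hpi, inv_mul_cancel₀ hpi0]
  have r2 : α⁻¹ * (Complex.Gamma (1 + α) * Complex.Gamma (1 + -α)) = π * (Complex.sin (π * α))⁻¹ := by
    rw [hrefl]; field_simp
  rw [show (1 / 2 + -α + lam₁) = 1 / 2 - α + lam₁ by ring, show (1 / 2 + -α + lam₂) = 1 / 2 - α + lam₂ by ring]
  have c1 : (Complex.Gamma (1 + lam₁))⁻¹ * Complex.Gamma (1 + lam₁) = 1 := inv_mul_cancel₀ G1
  have c2 : (Complex.Gamma (1 + lam₂))⁻¹ * Complex.Gamma (1 + lam₂) = 1 := inv_mul_cancel₀ G2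
  simp only [div_eq_mul_inv, mul_inv, one_mul] at *
  generalize (Complex.Gamma (2⁻¹ - α + lam₁))⁻¹ = g1 at *
  generalize (Complex.Gamma (2⁻¹ - α + lam₂))⁻¹ = g2 at *
  generalize (Complex.Gamma (2⁻¹ + α + lam₁))⁻¹ = g3 at *
  generalize (Complex.Gamma (2⁻¹ + α + lam₂))⁻¹ = g4 at *
  generalize (2 ^ (2⁻¹ - -α - lam₁) : ℂ)⁻¹ = q1 at *
  generalize (2 ^ (2⁻¹ - -α - lam₂) : ℂ)⁻¹ = q2 at *
  generalize (2 ^ (2⁻¹ - α - lam₁) : ℂ)⁻¹ = q3 at *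
  generalize (2 ^ (2⁻¹ - α - lam₂) : ℂ)⁻¹ = q4 at *
  generalize ((√π : ℝ) : ℂ)⁻¹ = sp at *
  generalize (Complex.Gamma (1 + lam₁))⁻¹ = u1 at *
  generalize (Complex.Gamma (1 + lam₂))⁻¹ = u2 at *
  generalize Complex.Gamma (1 + lam₁) = v1 at *
  generalize Complex.Gamma (1 + lam₂) = v2 at *
  generalize (Complex.sin (π * α))⁻¹ = sn at *
  generalize (lam₁ ^ 2 - lam₂ ^ 2)⁻¹ = kk at *
  generalize (2 ^ (lam₁ + lam₂ + 1) : ℂ) = T at *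
  generalize Complex.Gamma (1 + α) = A at *
  generalize Complex.Gamma (1 + -α) = B at *
  calc _ = (u1 * v1) * (u2 * v2) * (sp * sp * (α⁻¹ * (A * B))) * kk *
        ((q1 * q4 * 2 * 2) * (g1 * g4) - (q2 * q3 * 2 * 2) * (g2 * g3)) := by ring
    _ = (sp * sp * π) * sn * kk * (T * (g1 * g4) - T * (g2 * g3)) := by
        rw [c1, c2, r2, p1, p2]; ring
    _ = _ := by rw [s1]; ring
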